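/- For all natural numbers n0, n1 ≥ 1 with |n0 − n1| ≤ 2, the pair of stars ⟨K_{1,n0}, K_{1,n1}⟩ admits an MWG-drawing. -/

import Mathlib

noncomputable section

/-- The Euclidean plane. -/
abbrev Pt : Type := EuclideanSpace ℝ (Fin 2)

/-- The Gabriel disk `D[u,v]`: the closed disk having `u` and `v` as antipodal points. -/
def gabrielDisk (u v : Pt) : Set Pt := Metric.closedBall (midpoint ℝ u v) (dist u v / 2)

/-- `f` is a witness Gabriel drawing of the finite simple graph `G` with witness set `P`. -/
def IsWGDrawing {V : Type*} [Fintype V] (G : SimpleGraph V) (f : V → Pt) (P : Set Pt) : Prop :=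
  Function.Injective f ∧ Disjoint (Set.range f) P ∧
    ∀ u v : V, u ≠ v → (G.Adj u v ↔ gabrielDisk (f u) (f v) ∩ P = ∅)

/-- `⟨f₀, f₁⟩` is a mutual witness Gabriel drawing of the pair `⟨G₀, G₁⟩`. -/
def IsMWGDrawing {V₀ V₁ : Type*} [Fintype V₀] [Fintype V₁]
    (G₀ : SimpleGraph V₀) (G₁ : SimpleGraph V₁) (f₀ : V₀ → Pt) (f₁ : V₁ → Pt) : Prop :=
  Function.Injective f₀ ∧ Function.Injective f₁ ∧
    Disjoint (Set.range f₀) (Set.range f₁) ∧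
    (∀ u v : V₀, u ≠ v → (G₀.Adj u v ↔ gabrielDisk (f₀ u) (f₀ v) ∩ Set.range f₁ = ∅)) ∧
    (∀ u v : V₁, u ≠ v → (G₁.Adj u v ↔ gabrielDisk (f₁ u) (f₁ v) ∩ Set.range f₀ = ∅))

/-- Two subsets of the plane are linearly separable. -/
def LinSep (A B : Set Pt) : Prop :=
  ∃ (φ : Pt →ₗ[ℝ] ℝ) (c : ℝ), φ ≠ 0 ∧ (∀ a ∈ A, φ a < c) ∧ ∀ b ∈ B, c < φ b

/-- The scalar product `⟪u - w, v - w⟫` in coordinates. -/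
def gabrielDot (u v w : Pt) : ℝ :=
  (u 0 - w 0) * (v 0 - w 0) + (u 1 - w 1) * (v 1 - w 1)

lemma mem_gabrielDisk_iff (u v w : Pt) : w ∈ gabrielDisk u v ↔ gabrielDot u v w ≤ 0 := by
  have hd : (0 : ℝ) ≤ dist u v / 2 := by positivity
  rw [gabrielDisk, Metric.mem_closedBall, ← sq_le_sq₀ dist_nonneg hd, div_pow,
    EuclideanSpace.dist_sq_eq, EuclideanSpace.dist_sq_eq]
  simp only [Fin.sum_univ_two, Real.dist_eq, sq_abs, midpoint_eq_smul_add, PiLp.smul_apply,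
    PiLp.add_apply, smul_eq_mul, invOf_eq_inv, gabrielDot]
  constructor <;> intro h <;> nlinarith

lemma gabrielDot_comm (u v w : Pt) : gabrielDot u v w = gabrielDot v u w := by
  unfold gabrielDot; ring

lemma gabrielDot_right (u v : Pt) : gabrielDot u v v = 0 := by
  simp [gabrielDot]

lemma eq_of_gabrielDot_self_le {u w : Pt} (h : gabrielDot u u w ≤ 0) : u = w := by
  unfold gabrielDot at h
  have h0 := mul_self_nonneg (u 0 - w 0)
  have h1 := mul_self_nonneg (u 1 - w 1)
  refine PiLp.ext (Fin.forall_fin_two.2 ⟨?_, ?_⟩)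
  · exact sub_eq_zero.1 (mul_self_eq_zero.1 (le_antisymm (by linarith) h0))
  · exact sub_eq_zero.1 (mul_self_eq_zero.1 (le_antisymm (by linarith) h1))

/-- A criterion for a star with center `c` and leaves `a` to be a witness Gabriel drawing. -/
lemma isWGDrawing_star {n : ℕ} (hn : 0 < n) {c : Pt} {a : Fin n → Pt} {P : Set Pt}
    (hc : ∀ i, c ≠ a i) (hadj : ∀ i, ∀ w ∈ P, 0 < gabrielDot c (a i) w)
    (hleaf : ∀ i j, i < j → ∃ w ∈ P, gabrielDot (a i) (a j) w ≤ 0) :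
    IsWGDrawing (completeBipartiteGraph (Fin 1) (Fin n)) (Sum.elim (fun _ => c) a) P := by
  have hleaf' : ∀ i j, i ≠ j → ∃ w ∈ P, gabrielDot (a i) (a j) w ≤ 0 := by
    intro i j hij
    rcases lt_or_gt_of_ne hij with h | h
    · exact hleaf i j h
    · obtain ⟨w, hw, h'⟩ := hleaf j i h
      exact ⟨w, hw, gabrielDot_comm (a i) (a j) w ▸ h'⟩
  have hcP : c ∉ P := fun h => by
    have := hadj ⟨0, hn⟩ c h
    rw [gabrielDot_comm, gabrielDot_right] at this
    exact lt_irrefl _ this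
  have haP : ∀ i, a i ∉ P := fun i h => by
    have := hadj i _ h
    rw [gabrielDot_right] at this
    exact lt_irrefl _ this
  have hinj : Function.Injective a := by
    intro i j hij
    by_contra hne
    obtain ⟨w, hw, h⟩ := hleaf' i j hne
    rw [← hij] at h
    exact haP i (eq_of_gabrielDot_self_le h ▸ hw)
  have hempty : ∀ u v : Pt, gabrielDisk u v ∩ P = ∅ ↔ ∀ w ∈ P, 0 < gabrielDot u v w := by
    intro u v
    simp only [Set.eq_empty_iff_forall_notMem, Set.mem_inter_iff, mem_gabrielDisk_iff, not_and]
    exact ⟨fun h w hw => not_le.1 fun h' => h w h' hw, fun h w h' hw => (h w hw).not_ge h'⟩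
  refine ⟨?_, ?_, ?_⟩
  · exact Function.Injective.sumElim (Function.injective_of_subsingleton _) hinj
      fun _ i => hc i
  · rw [Set.disjoint_left]
    rintro _ ⟨_ | i, rfl⟩
    · exact hcP
    · exact haP i
  · rintro (u | i) (v | j) huv
    · exact absurd (congrArg Sum.inl (Subsingleton.elim u v)) huv
    · simpa [hempty] using hadj j
    · simpa [hempty, gabrielDot_comm (a i) c] using hadj i
    · have hij : i ≠ j := fun h => huv (congrArg Sum.inr h)
      simpa [hempty] using hleaf' i j hij

lemma IsWGDrawing.isMWGDrawing {V₀ V₁ : Type*} [Fintype V₀] [Fintype V₁]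
    {G₀ : SimpleGraph V₀} {G₁ : SimpleGraph V₁} {f₀ : V₀ → Pt} {f₁ : V₁ → Pt}
    (h₀ : IsWGDrawing G₀ f₀ (Set.range f₁)) (h₁ : IsWGDrawing G₁ f₁ (Set.range f₀)) :
    IsMWGDrawing G₀ G₁ f₀ f₁ :=
  ⟨h₀.1, h₁.1, h₀.2.1, h₀.2.2, h₁.2.2⟩

lemma IsMWGDrawing.symm {V₀ V₁ : Type*} [Fintype V₀] [Fintype V₁]
    {G₀ : SimpleGraph V₀} {G₁ : SimpleGraph V₁} {f₀ : V₀ → Pt} {f₁ : V₁ → Pt}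
    (h : IsMWGDrawing G₀ G₁ f₀ f₁) : IsMWGDrawing G₁ G₀ f₁ f₀ :=
  ⟨h.2.1, h.1, h.2.2.1.symm, h.2.2.2.2, h.2.2.2.1⟩

/-- Leaves of the two stars alternate in height on the lines `x = 0` and `x = 1`, and the centers
are far away. The leaf of index `n + 1`, if present, lies straight above the center of the smaller
star, which separates it from the other leaves. -/
lemma exists_isMWGDrawing_star {m n : ℕ} (hn : 1 ≤ n) (hnm : n ≤ m) (hmn : m ≤ n + 2) :
    ∃ (f₀ : Fin 1 ⊕ Fin m → Pt) (f₁ : Fin 1 ⊕ Fin n → Pt),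
      IsMWGDrawing (completeBipartiteGraph (Fin 1) (Fin m))
        (completeBipartiteGraph (Fin 1) (Fin n)) f₀ f₁ := by
  obtain ⟨L, hL⟩ : ∃ L : ℝ, L = 2 * n + 1 := ⟨_, rfl⟩
  obtain ⟨X, hX⟩ : ∃ X : ℝ, X = L ^ 2 + 1 := ⟨_, rfl⟩
  have hn' : (1 : ℝ) ≤ n := by exact_mod_cast hn
  have hL3 : 3 ≤ L := by linarith
  have hX10 : 10 ≤ X := by nlinarith
  have hXL : L < X := by nlinarith
  let a : Fin m → Pt := fun i => if (i : ℕ) = n + 1 then !₂[X, L + X ^ 2] else !₂[0, 2 * (i : ℝ)]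
  let b : Fin n → Pt := fun j => !₂[1, 2 * (j : ℝ) + 1]
  have ha : ∀ i : Fin m, a i = !₂[X, L + X ^ 2] ∨
      ∃ y : ℝ, 0 ≤ y ∧ y ≤ L - 1 ∧ a i = !₂[0, y] := by
    intro i
    by_cases hi : (i : ℕ) = n + 1
    · exact Or.inl (if_pos hi)
    · refine Or.inr ⟨2 * (i : ℝ), by positivity, ?_, if_neg hi⟩
      have : (i : ℕ) ≤ n := by omega
      have : (i : ℝ) ≤ n := by exact_mod_cast this
      linarith
  have hb : ∀ j : Fin n, ∃ z : ℝ, 1 ≤ z ∧ z ≤ L - 2 ∧ b j = !₂[1, z] := by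
    intro j
    refine ⟨2 * (j : ℝ) + 1, by linarith [(j : ℕ).cast_nonneg (α := ℝ)], ?_, rfl⟩
    have : (j : ℝ) + 1 ≤ n := by exact_mod_cast j.2
    linarith
  refine ⟨Sum.elim (fun _ => !₂[-X, L + 1]) a, Sum.elim (fun _ => !₂[X, L]) b,
    (isWGDrawing_star (by omega) ?_ ?_ ?_).isMWGDrawing (isWGDrawing_star hn ?_ ?_ ?_)⟩
  · intro i h
    have h0 := congrArg (fun p : Pt => p 0) h
    obtain hi | ⟨y, _, _, hi⟩ := ha i <;> simp [hi] at h0 <;> linarith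
  · rintro i _ ⟨_ | j, rfl⟩
    · obtain hi | ⟨y, hy0, hyL, hi⟩ := ha i
      · simp only [gabrielDot, Sum.elim_inl, hi]
        simp
        positivity
      · simp only [gabrielDot, Sum.elim_inl, hi]
        simp
        nlinarith
    · obtain ⟨z, hz1, hzL, hj⟩ := hb j
      obtain hi | ⟨y, hy0, hyL, hi⟩ := ha i
      · simp only [gabrielDot, Sum.elim_inr, hi, hj]
        simp
        nlinarith [mul_nonneg (by linarith : 0 ≤ L - 2 - z) (sq_nonneg X),
          mul_nonneg (by linarith : 0 ≤ L - 2 - z) (by linarith : 0 ≤ L - 2 - z)]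
      · simp only [gabrielDot, Sum.elim_inr, hi, hj]
        simp
        nlinarith [mul_nonneg (by linarith : 0 ≤ L + 1 - z) hy0,
          mul_nonneg (by linarith : 0 ≤ L - 2 - z) (by linarith : 0 ≤ z - 1)]
  · intro i j hij
    have hij' : (i : ℕ) < j := hij
    have hi : a i = !₂[0, 2 * (i : ℝ)] := if_neg (by omega)
    by_cases hj : (j : ℕ) = n + 1
    · refine ⟨_, ⟨Sum.inl 0, rfl⟩, ?_⟩
      have hj : a j = !₂[X, L + X ^ 2] := if_pos hj
      have : (i : ℕ) ≤ n := by omega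
      have : (i : ℝ) ≤ n := by exact_mod_cast this
      simp only [gabrielDot, Sum.elim_inl, hi, hj]
      simp
      exact mul_nonpos_of_nonpos_of_nonneg (by linarith) (sq_nonneg X)
    · refine ⟨_, ⟨Sum.inr ⟨i, by omega⟩, rfl⟩, ?_⟩
      have hj : a j = !₂[0, 2 * (j : ℝ)] := if_neg hj
      have : (i : ℝ) + 1 ≤ j := by exact_mod_cast hij'
      simp only [gabrielDot, Sum.elim_inr, hi, hj, b]
      simp
      linarith
  · intro j h
    have h0 := congrArg (fun p : Pt => p 0) h
    obtain ⟨z, _, _, hj⟩ := hb j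
    simp [hj] at h0
    linarith
  · rintro j _ ⟨_ | i, rfl⟩
    · obtain ⟨z, hz1, hzL, hj⟩ := hb j
      simp only [gabrielDot, Sum.elim_inl, hj]
      simp
      nlinarith
    · obtain ⟨z, hz1, hzL, hj⟩ := hb j
      obtain hi | ⟨y, hy0, hyL, hi⟩ := ha i
      · simp only [gabrielDot, Sum.elim_inr, hi, hj]
        simp
        nlinarith [mul_pos (pow_pos (by linarith : 0 < X) 2)
          (by nlinarith : 0 < L + X ^ 2 - z)]
      · simp only [gabrielDot, Sum.elim_inr, hi, hj]
        simp
        nlinarith [mul_nonneg (by linarith : 0 ≤ L - y) (by linarith : 0 ≤ z),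
          mul_nonneg (by linarith : 0 ≤ L - y) hy0]
  · intro i j hij
    have hij' : (i : ℕ) < j := hij
    refine ⟨_, ⟨Sum.inr ⟨i + 1, by omega⟩, rfl⟩, ?_⟩
    have hi : a ⟨i + 1, by omega⟩ = !₂[0, 2 * ((i + 1 : ℕ) : ℝ)] :=
      if_neg (by simp only; omega)
    have : (i : ℝ) + 1 ≤ j := by exact_mod_cast hij'
    simp only [gabrielDot, Sum.elim_inr, hi, b]
    simp
    linarith

/-- Lemma 5: the pair of stars `⟨K_{1,n₀}, K_{1,n₁}⟩` has an MWG-drawing if `|n₀ - n₁| ≤ 2`. -/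
theorem stmt10 (n₀ n₁ : ℕ) (h₀ : 1 ≤ n₀) (h₁ : 1 ≤ n₁)
    (hdiff : |(n₀ : ℤ) - (n₁ : ℤ)| ≤ 2) :
    ∃ (f₀ : Fin 1 ⊕ Fin n₀ → Pt) (f₁ : Fin 1 ⊕ Fin n₁ → Pt),
      IsMWGDrawing (completeBipartiteGraph (Fin 1) (Fin n₀))
        (completeBipartiteGraph (Fin 1) (Fin n₁)) f₀ f₁ := by
  rw [abs_le] at hdiff
  rcases le_total n₁ n₀ with h | h
  · exact exists_isMWGDrawing_star h₁ h (by omega)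
  · obtain ⟨f₁, f₀, hf⟩ := exists_isMWGDrawing_star (m := n₁) h₀ h (by omega)
    exact ⟨f₀, f₁, hf.symm⟩
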